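/- arXiv:1105.2220 — 6 statements merged into one kernel-verified Lean document; each statement's English description precedes it below -/
import Mathlib

section
/- Let d ≥ 1, let λ = (λ_1,…,λ_d) ∈ (0,1)^d, and let C : [0,1]^d → [0,1] be max-stable. Define D : [0,1]^d → ℝ by D(u) = (∏_{j=1}^d u_j^{1−λ_j}) · C(u_1^{λ_1},…,u_d^{λ_d}). Then D is max-stable, i.e., D(u) = (D(u^{1/r}))^r for all u ∈ [0,1]^d and all r > 0 (Khoudraji's device preserves max-stability). -/
/-- Khoudraji's device preserves max-stability. -/
theorem stmt1 (d : ℕ) (hd : 1 ≤ d) (lam : Fin d → ℝ)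
    (hlam : ∀ j, lam j ∈ Set.Ioo (0:ℝ) 1)
    (C : (Fin d → ℝ) → ℝ)
    (hC : ∀ u : Fin d → ℝ, (∀ i, u i ∈ Set.Icc (0:ℝ) 1) → C u ∈ Set.Icc (0:ℝ) 1)
    (hms : ∀ u : Fin d → ℝ, (∀ i, u i ∈ Set.Icc (0:ℝ) 1) → ∀ r : ℝ, 0 < r →
        C u = (C (fun i => u i ^ (1 / r))) ^ r)
    (D : (Fin d → ℝ) → ℝ)
    (hD : ∀ u : Fin d → ℝ,
        D u = (∏ j, u j ^ (1 - lam j)) * C (fun j => u j ^ lam j)) :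
    ∀ u : Fin d → ℝ, (∀ i, u i ∈ Set.Icc (0:ℝ) 1) → ∀ r : ℝ, 0 < r →
        D u = (D (fun i => u i ^ (1 / r))) ^ r := by
  intro u hu r hr
  have rpow_mem : ∀ a : ℝ, 0 ≤ a → ∀ v : Fin d → ℝ, (∀ i, v i ∈ Set.Icc (0:ℝ) 1) →
      ∀ i, v i ^ a ∈ Set.Icc (0:ℝ) 1 := fun a ha v hv i =>
    ⟨Real.rpow_nonneg (hv i).1 a, Real.rpow_le_one (hv i).1 (hv i).2 ha⟩
  have hw := rpow_mem (1 / r) (by positivity) u hu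
  have hprod : ∀ j, 0 ≤ (u j ^ (1 / r)) ^ (1 - lam j) := fun j =>
    Real.rpow_nonneg (hw j).1 _
  have hlam_mem : ∀ v : Fin d → ℝ, (∀ i, v i ∈ Set.Icc (0:ℝ) 1) →
      ∀ i, v i ^ lam i ∈ Set.Icc (0:ℝ) 1 := fun v hv i =>
    rpow_mem (lam i) (hlam i).1.le v hv i
  have hcomm : (fun i => (u i ^ lam i) ^ (1 / r)) = fun i => (u i ^ (1 / r)) ^ lam i := by
    funext i
    rw [← Real.rpow_mul (hu i).1, mul_comm, Real.rpow_mul (hu i).1]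
  rw [hD, hD, Real.mul_rpow (Finset.prod_nonneg fun j _ => hprod j) (hC _ (hlam_mem _ hw)).1,
    ← Real.finsetProd_rpow _ _ fun j _ => hprod j, hms _ (hlam_mem u hu) r hr, hcomm]
  congr 1
  refine Finset.prod_congr rfl fun j _ => ?_
  rw [← Real.rpow_mul (hu j).1, ← Real.rpow_mul (hu j).1]
  congr 1
  field_simp
end

section
/- Let d ≥ 1. For each n ∈ ℕ let β_n be a finite Borel measure on [0,1]^d with c.d.f. b_n, and let β_0 be a finite Borel measure on [0,1]^d with c.d.f. b_0. Let a_n, a_0 : [0,1]^d → ℝ be bounded Borel measurable functions. Assume a_0 is continuous on [0,1]^d, b_0 is continuous on [0,1]^d, sup_{u ∈ [0,1]^d} |a_n(u) − a_0(u)| → 0 and sup_{u ∈ [0,1]^d} |b_n(u) − b_0(u)| → 0 as n → ∞. Then ∫_{[0,1]^d} a_n dβ_n → ∫_{[0,1]^d} a_0 dβ_0 as n → ∞. -/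
open MeasureTheory

/-- The functions `v ↦ m [v, ∞)`, for `m` a finite measure. -/
def IsUpperCdf {X : Type*} [Preorder X] [MeasurableSpace X] (f : X → ℝ) : Prop :=
  ∃ m : Measure X, IsFiniteMeasure m ∧ ∀ v, f v = m.real (Set.Ici v)

section UpperCdf

variable {X : Type*} [TopologicalSpace X] [MeasurableSpace X] [BorelSpace X]

theorem IsUpperCdf.one [PartialOrder X] [OrderTop X] [OrderClosedTopology X] :
    IsUpperCdf (1 : X → ℝ) :=
  ⟨Measure.dirac ⊤, inferInstance, fun v => by
    simp [Measure.real, Measure.dirac_apply' _ (measurableSet_Ici (a := v))]⟩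

variable [SecondCountableTopology X]

theorem IsUpperCdf.mul [Lattice X] [OrderClosedTopology X] [ContinuousInf X] {f g : X → ℝ}
    (hf : IsUpperCdf f) (hg : IsUpperCdf g) : IsUpperCdf (f * g) := by
  obtain ⟨m, hm, hfm⟩ := hf
  obtain ⟨m', hm', hgm'⟩ := hg
  refine ⟨(m.prod m').map fun p => p.1 ⊓ p.2, inferInstance, fun v => ?_⟩
  have hpre : (fun p : X × X => p.1 ⊓ p.2) ⁻¹' Set.Ici v = Set.Ici v ×ˢ Set.Ici v := by
    ext p
    simp [-Set.Ici_prod_Ici]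
  rw [map_measureReal_apply (by fun_prop) measurableSet_Ici, hpre, measureReal_prod_prod,
    Pi.mul_apply, hfm, hgm']

theorem integral_measureReal_Ici [PartialOrder X] [OrderClosedTopology X]
    (μ m : Measure X) [IsFiniteMeasure μ] [IsFiniteMeasure m] :
    ∫ v, m.real (Set.Ici v) ∂μ = ∫ u, μ.real (Set.Iic u) ∂m := by
  have hs : MeasurableSet {p : X × X | p.1 ≤ p.2} := measurableSet_le'
  have h : Integrable ({p : X × X | p.1 ≤ p.2}.indicator (1 : X × X → ℝ)) (μ.prod m) :=
    (integrable_const (1 : ℝ)).indicator hs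
  have h' := integral_integral_swap (f := fun u v =>
    {p : X × X | p.1 ≤ p.2}.indicator (1 : X × X → ℝ) (u, v)) h
  have h₁ (u v : X) : {p : X × X | p.1 ≤ p.2}.indicator (1 : X × X → ℝ) (u, v) =
    (Set.Ici u).indicator 1 v := rfl
  have h₂ (u v : X) : {p : X × X | p.1 ≤ p.2}.indicator (1 : X × X → ℝ) (u, v) =
    (Set.Iic v).indicator 1 u := rfl
  simp_rw [h₁, integral_indicator_one measurableSet_Ici] at h'
  rw [h']
  refine integral_congr_ae (ae_of_all _ fun v => ?_)
  exact integral_indicator_one measurableSet_Iic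

theorem tendsto_integral_of_isUpperCdf [PartialOrder X] [OrderClosedTopology X]
    {β : ℕ → Measure X} {β₀ : Measure X} [∀ n, IsFiniteMeasure (β n)] [IsFiniteMeasure β₀]
    (h : TendstoUniformly (fun n u => (β n).real (Set.Iic u)) (fun u => β₀.real (Set.Iic u))
      Filter.atTop)
    {f : X → ℝ} (hf : IsUpperCdf f) :
    Filter.Tendsto (fun n => ∫ u, f u ∂(β n)) Filter.atTop (nhds (∫ u, f u ∂β₀)) := by
  obtain ⟨m, hm, hfm⟩ := hf
  simp only [hfm, integral_measureReal_Ici]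
  have hint (μ : Measure X) [IsFiniteMeasure μ] : AEStronglyMeasurable
      (fun u => μ.real (Set.Iic u)) m :=
    (measurable_measure_prodMk_right
      (measurableSet_le' (α := X))).ennreal_toReal.aestronglyMeasurable
  refine tendsto_integral_filter_of_norm_le_const (.of_forall fun n => hint _)
    ⟨β₀.real .univ + 1, ?_⟩ (ae_of_all _ fun u => h.tendsto_at u)
  filter_upwards [Metric.tendstoUniformly_iff.1 h 1 one_pos] with n hn
  refine ae_of_all _ fun u => ?_
  have h₁ := hn u
  have h₂ : β₀.real (Set.Iic u) ≤ β₀.real .univ := measureReal_mono (Set.subset_univ _)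
  rw [Real.dist_eq, abs_lt] at h₁
  rw [Real.norm_eq_abs, abs_of_nonneg measureReal_nonneg]
  linarith

theorem tendsto_integral_of_mem_adjoin [CompactSpace X] [Lattice X] [OrderTop X]
    [OrderClosedTopology X] [ContinuousInf X]
    {β : ℕ → Measure X} {β₀ : Measure X} [∀ n, IsFiniteMeasure (β n)] [IsFiniteMeasure β₀]
    (h : TendstoUniformly (fun n u => (β n).real (Set.Iic u)) (fun u => β₀.real (Set.Iic u))
      Filter.atTop)
    {f : C(X, ℝ)} (hf : f ∈ Algebra.adjoin ℝ {g : C(X, ℝ) | IsUpperCdf g}) :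
    Filter.Tendsto (fun n => ∫ u, f u ∂(β n)) Filter.atTop (nhds (∫ u, f u ∂β₀)) := by
  let S : Submonoid C(X, ℝ) :=
    { carrier := {g | IsUpperCdf g}
      mul_mem' := fun hf hg => IsUpperCdf.mul hf hg
      one_mem' := IsUpperCdf.one }
  have hint (g : C(X, ℝ)) (μ : Measure X) [IsFiniteMeasure μ] : Integrable g μ :=
    g.continuous.integrable_of_hasCompactSupport (HasCompactSupport.of_compactSpace g)
  rw [← Subalgebra.mem_toSubmodule, Algebra.adjoin_eq_span,
    show {g : C(X, ℝ) | IsUpperCdf g} = S from rfl, Submonoid.closure_eq] at hf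
  induction hf using Submodule.span_induction with
  | mem g hg => exact tendsto_integral_of_isUpperCdf h hg
  | zero => simp
  | add f g _ _ hf hg =>
    simpa [integral_add (hint f _) (hint g _)] using hf.add hg
  | smul c f _ hf =>
    simpa [integral_const_mul] using hf.const_mul c

end UpperCdf

theorem tendsto_integral_of_approx {X : Type*} [MeasurableSpace X]
    {β : ℕ → Measure X} {β₀ : Measure X} [∀ n, IsFiniteMeasure (β n)] [IsFiniteMeasure β₀]
    (hmass : Filter.Tendsto (fun n => (β n).real .univ) Filter.atTop (nhds (β₀.real .univ)))
    {a : ℕ → X → ℝ} {a₀ : X → ℝ} (ha : ∀ n, Integrable (a n) (β n)) (ha₀ : Integrable a₀ β₀)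
    (haconv : TendstoUniformly a a₀ Filter.atTop)
    (happrox : ∀ ε > 0, ∃ g : X → ℝ, (∀ u, |g u - a₀ u| < ε) ∧ (∀ n, Integrable g (β n)) ∧
      Integrable g β₀ ∧
      Filter.Tendsto (fun n => ∫ u, g u ∂(β n)) Filter.atTop (nhds (∫ u, g u ∂β₀))) :
    Filter.Tendsto (fun n => ∫ u, a n u ∂(β n)) Filter.atTop (nhds (∫ u, a₀ u ∂β₀)) := by
  rw [Metric.tendsto_nhds]
  intro ε hε
  set M := β₀.real .univ with hM
  have hM0 : 0 ≤ M := measureReal_nonneg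
  obtain ⟨δ, hδ, hδM⟩ : ∃ δ > 0, δ * (3 * M + 3) = ε :=
    ⟨ε / (3 * M + 3), by positivity, by field_simp⟩
  obtain ⟨g, hga, hgn, hg₀, hg⟩ := happrox δ hδ
  filter_upwards [Metric.tendsto_nhds.1 hg δ hδ, Metric.tendstoUniformly_iff.1 haconv δ hδ,
    hmass.eventually_le_const (lt_add_one M)] with n h₁ h₂ h₃
  rw [Real.dist_eq] at h₁ ⊢
  have h₄ : |∫ u, a n u ∂(β n) - ∫ u, g u ∂(β n)| ≤ 2 * δ * (β n).real .univ := by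
    rw [← integral_sub (ha n) (hgn n), ← Real.norm_eq_abs]
    refine norm_integral_le_of_norm_le_const (ae_of_all _ fun u => ?_)
    have h := h₂ u
    have h' := hga u
    rw [Real.dist_eq, abs_lt] at h
    rw [abs_lt] at h'
    rw [Real.norm_eq_abs, abs_le]
    constructor <;> linarith
  have h₅ : |∫ u, g u ∂β₀ - ∫ u, a₀ u ∂β₀| ≤ δ * M := by
    rw [← integral_sub hg₀ ha₀, ← Real.norm_eq_abs]
    exact norm_integral_le_of_norm_le_const (ae_of_all _ fun u => (hga u).le)
  have h₆ : 2 * δ * (β n).real .univ ≤ 2 * δ * (M + 1) := by gcongr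
  rw [abs_lt] at h₁ ⊢
  rw [abs_le] at h₄ h₅
  constructor <;> linarith

theorem continuousInf_pi {ι : Type*} {X : ι → Type*} [∀ i, TopologicalSpace (X i)]
    [∀ i, Min (X i)] [∀ i, ContinuousInf (X i)] : ContinuousInf (∀ i, X i) :=
  ⟨continuous_pi fun i =>
    ((continuous_apply i).comp continuous_fst).inf ((continuous_apply i).comp continuous_snd)⟩

theorem isUpperCdf_one_sub_apply {ι : Type*} [Fintype ι] (j : ι) :
    IsUpperCdf fun v : ι → unitInterval => 1 - (v j : ℝ) := by
  classical
  refine ⟨(volume : Measure unitInterval).map (Function.update ⊤ j), inferInstance, fun v => ?_⟩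
  have hpre : Function.update (⊤ : ι → unitInterval) j ⁻¹' Set.Ici v = Set.Ici (v j) := by
    ext t
    simp only [Set.mem_preimage, Set.mem_Ici, le_update_iff, and_iff_left_iff_imp]
    exact fun _ i _ => le_top
  rw [map_measureReal_apply (measurable_update _) measurableSet_Ici, hpre, Measure.real,
    unitInterval.volume_Ici, ENNReal.toReal_ofReal (sub_nonneg.2 (v j).2.2)]

theorem separatesPoints_adjoin_isUpperCdf {ι : Type*} [Fintype ι] :
    (Algebra.adjoin ℝ {g : C(ι → unitInterval, ℝ) | IsUpperCdf g}).SeparatesPoints := by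
  intro x y hxy
  obtain ⟨j, hj⟩ := Function.ne_iff.1 hxy
  refine ⟨_, ⟨⟨fun v => 1 - (v j : ℝ), by fun_prop⟩,
    Algebra.subset_adjoin (isUpperCdf_one_sub_apply j), rfl⟩, fun h => hj ?_⟩
  exact Subtype.ext (sub_right_injective h)

/-- If `aₙ → a₀` uniformly with `a₀` continuous, and the c.d.f.s `bₙ`
of the finite Borel measures `βₙ` on `[0,1]^d` converge uniformly to the continuous
c.d.f. `b₀` of `β₀`, then `∫ aₙ dβₙ → ∫ a₀ dβ₀`. -/
theorem stmt2 (d : ℕ) (hd : 1 ≤ d)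
    (β : ℕ → Measure (Fin d → Set.Icc (0:ℝ) 1))
    (β₀ : Measure (Fin d → Set.Icc (0:ℝ) 1))
    (hβfin : ∀ n, IsFiniteMeasure (β n)) (hβ₀fin : IsFiniteMeasure β₀)
    (a : ℕ → (Fin d → Set.Icc (0:ℝ) 1) → ℝ) (a₀ : (Fin d → Set.Icc (0:ℝ) 1) → ℝ)
    (hameas : ∀ n, Measurable (a n)) (habdd : ∀ n, ∃ M : ℝ, ∀ u, |a n u| ≤ M)
    (ha₀meas : Measurable a₀) (ha₀bdd : ∃ M : ℝ, ∀ u, |a₀ u| ≤ M)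
    (ha₀cont : Continuous a₀)
    (b : ℕ → (Fin d → Set.Icc (0:ℝ) 1) → ℝ) (b₀ : (Fin d → Set.Icc (0:ℝ) 1) → ℝ)
    (hb : ∀ n u, b n u = ((β n) {v | ∀ j, v j ≤ u j}).toReal)
    (hb₀ : ∀ u, b₀ u = (β₀ {v | ∀ j, v j ≤ u j}).toReal)
    (hb₀cont : Continuous b₀)
    (haconv : TendstoUniformly a a₀ Filter.atTop)
    (hbconv : TendstoUniformly b b₀ Filter.atTop) :
    Filter.Tendsto (fun n => ∫ u, a n u ∂(β n)) Filter.atTop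
      (nhds (∫ u, a₀ u ∂β₀)) := by
  obtain rfl : b = fun n u => (β n).real (Set.Iic u) := funext₂ hb
  obtain rfl : b₀ = fun u => β₀.real (Set.Iic u) := funext hb₀
  have hint (f : (Fin d → Set.Icc (0:ℝ) 1) → ℝ) (hf : Measurable f)
      (hM : ∃ M : ℝ, ∀ u, |f u| ≤ M) (μ : Measure (Fin d → Set.Icc (0:ℝ) 1))
      [IsFiniteMeasure μ] : Integrable f μ :=
    hM.elim fun M hM => .of_bound hf.aestronglyMeasurable M (ae_of_all _ hM)
  have hintc (g : C(Fin d → Set.Icc (0:ℝ) 1, ℝ)) (μ : Measure (Fin d → Set.Icc (0:ℝ) 1))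
      [IsFiniteMeasure μ] : Integrable g μ :=
    g.continuous.integrable_of_hasCompactSupport (HasCompactSupport.of_compactSpace g)
  refine tendsto_integral_of_approx (by simpa using hbconv.tendsto_at ⊤)
    (fun n => hint _ (hameas n) (habdd n) _) (hint _ ha₀meas ha₀bdd _) haconv fun ε hε => ?_
  obtain ⟨g, hg⟩ := ContinuousMap.exists_mem_subalgebra_near_continuous_of_separatesPoints _
    separatesPoints_adjoin_isUpperCdf a₀ ha₀cont ε hε
  have : ContinuousInf (Fin d → Set.Icc (0:ℝ) 1) := continuousInf_pi
  exact ⟨g, hg, fun n => hintc _ _, hintc _ _, tendsto_integral_of_mem_adjoin hbconv g.2⟩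
end

section
/- Let d ≥ 1. For each n ∈ ℕ let β_n be a finite Borel measure on [0,1]^d with c.d.f. b_n, and let β_0 be a finite Borel measure on [0,1]^d with c.d.f. b_0. If b_0 is continuous on [0,1]^d and sup_{u ∈ [0,1]^d} |b_n(u) − b_0(u)| → 0 as n → ∞, then β_n converges weakly to β_0: for every continuous function f : [0,1]^d → ℝ, ∫_{[0,1]^d} f dβ_n → ∫_{[0,1]^d} f dβ_0 as n → ∞. -/
open MeasureTheory

open Filter Topology

section OrderedSpace

variable {X : Type*} [TopologicalSpace X] [Lattice X] [OrderClosedTopology X]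
  [SecondCountableTopology X] [MeasurableSpace X] [BorelSpace X]

/-- The survival function of a measure integrates to the integral of the c.d.f. of the other. -/
theorem integral_real_Ici_eq_integral_real_Iic (μ τ : Measure X) [IsFiniteMeasure μ]
    [IsFiniteMeasure τ] :
    ∫ u, τ.real (Set.Ici u) ∂μ = ∫ t, μ.real (Set.Iic t) ∂τ := by
  have hs : MeasurableSet {p : X × X | p.1 ≤ p.2} := measurableSet_le'
  have h1 : Measurable fun u => τ (Set.Ici u) := measurable_measure_prodMk_left (ν := τ) hs
  have h2 : Measurable fun t => μ (Set.Iic t) := measurable_measure_prodMk_right (μ := μ) hs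
  have key : ∫⁻ u, τ (Set.Ici u) ∂μ = ∫⁻ t, μ (Set.Iic t) ∂τ :=
    (Measure.prod_apply (μ := μ) (ν := τ) hs).symm.trans (Measure.prod_apply_symm hs)
  simp only [measureReal_def]
  rw [integral_toReal h1.aemeasurable (ae_of_all _ fun _ => measure_lt_top _ _),
    integral_toReal h2.aemeasurable (ae_of_all _ fun _ => measure_lt_top _ _), key]

theorem measurable_real_Iic (μ : Measure X) [IsFiniteMeasure μ] :
    Measurable fun t => μ.real (Set.Iic t) := by
  have hs : MeasurableSet {p : X × X | p.1 ≤ p.2} := measurableSet_le'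
  exact (measurable_measure_prodMk_right (μ := μ) hs).ennreal_toReal

/-- Pointwise convergence of c.d.f.s implies convergence of integrals of survival functions. -/
theorem tendsto_integral_real_Ici_of_tendsto_real_Iic {μ : ℕ → Measure X} {μ₀ : Measure X}
    [∀ n, IsFiniteMeasure (μ n)] [IsFiniteMeasure μ₀] {C : ℝ}
    (hC : ∀ n, (μ n).real Set.univ ≤ C)
    (h : ∀ t, Tendsto (fun n => (μ n).real (Set.Iic t)) atTop (𝓝 (μ₀.real (Set.Iic t))))
    (τ : Measure X) [IsFiniteMeasure τ] :
    Tendsto (fun n => ∫ u, τ.real (Set.Ici u) ∂μ n) atTop (𝓝 (∫ u, τ.real (Set.Ici u) ∂μ₀)) := by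
  simp only [integral_real_Ici_eq_integral_real_Iic]
  refine tendsto_integral_of_dominated_convergence (fun _ => C)
    (fun n => (measurable_real_Iic (μ n)).aestronglyMeasurable) (integrable_const C)
    (fun n => ae_of_all _ fun t => ?_) (ae_of_all _ h)
  rw [Real.norm_of_nonneg measureReal_nonneg]
  exact (measureReal_mono (Set.subset_univ _)).trans (hC n)

end OrderedSpace

instance Pi.continuousInf {ι : Type*} {X : ι → Type*} [∀ i, TopologicalSpace (X i)]
    [∀ i, Min (X i)] [∀ i, ContinuousInf (X i)] : ContinuousInf (∀ i, X i) where
  continuous_inf := continuous_pi fun i =>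
    ((continuous_apply i).comp continuous_fst).inf ((continuous_apply i).comp continuous_snd)

/-- The continuous survival functions of finite measures form a submonoid: the product of two of
them is the survival function of the law of the infimum of independent samples. -/
def survivalSubmonoid (X : Type*) [TopologicalSpace X] [Lattice X] [OrderTop X]
    [OrderClosedTopology X] [ContinuousInf X] [SecondCountableTopology X] [MeasurableSpace X]
    [BorelSpace X] : Submonoid C(X, ℝ) where
  carrier := {f | ∃ τ : Measure X, IsFiniteMeasure τ ∧ ∀ u, f u = τ.real (Set.Ici u)}
  one_mem' := ⟨Measure.dirac ⊤, inferInstance, fun u => by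
    simp [measureReal_def, Measure.dirac_apply' _ (measurableSet_Ici (a := u))]⟩
  mul_mem' := by
    rintro f g ⟨τ, hτ, hf⟩ ⟨σ, hσ, hg⟩
    have hm : Measurable fun p : X × X => p.1 ⊓ p.2 := continuous_inf.measurable
    refine ⟨(τ.prod σ).map fun p => p.1 ⊓ p.2, inferInstance, fun u => ?_⟩
    have hpre : (fun p : X × X => p.1 ⊓ p.2) ⁻¹' Set.Ici u = Set.Ici u ×ˢ Set.Ici u := by
      ext p
      simp only [Set.mem_preimage, Set.mem_Ici, le_inf_iff, Set.mem_prod]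
    rw [map_measureReal_apply hm measurableSet_Ici, hpre, measureReal_prod_prod,
      ContinuousMap.mul_apply, hf, hg]

theorem integrable_continuousMap_of_compactSpace {X : Type*} [TopologicalSpace X] [CompactSpace X]
    [MeasurableSpace X] [OpensMeasurableSpace X] (ν : Measure X) [IsFiniteMeasure ν]
    (f : C(X, ℝ)) : Integrable f ν :=
  f.continuous.integrable_of_hasCompactSupport (HasCompactSupport.of_compactSpace f)

/-- Convergence of integrals against measures of bounded mass is a closed condition. -/
theorem isClosed_setOf_tendsto_integral {X : Type*} [TopologicalSpace X] [CompactSpace X]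
    [MeasurableSpace X] [OpensMeasurableSpace X] {μ : ℕ → Measure X} {μ₀ : Measure X}
    [∀ n, IsFiniteMeasure (μ n)] [IsFiniteMeasure μ₀] {C : ℝ}
    (hC : ∀ n, (μ n).real Set.univ ≤ C) :
    IsClosed {f : C(X, ℝ) | Tendsto (fun n => ∫ u, f u ∂μ n) atTop (𝓝 (∫ u, f u ∂μ₀))} := by
  have hlip (ν : Measure X) [IsFiniteMeasure ν] {K : ℝ} (hK : ν.real Set.univ ≤ K) :
      LipschitzWith K.toNNReal fun f : C(X, ℝ) => ∫ u, f u ∂ν := by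
    refine LipschitzWith.of_dist_le' fun f g => ?_
    rw [dist_eq_norm, ← integral_sub (integrable_continuousMap_of_compactSpace ν f)
      (integrable_continuousMap_of_compactSpace ν g), mul_comm]
    refine (norm_integral_le_of_norm_le_const (ae_of_all _ fun u => ?_)).trans
      (mul_le_mul_of_nonneg_left hK dist_nonneg)
    rw [← dist_eq_norm]
    exact ContinuousMap.dist_apply_le_dist u
  exact (LipschitzWith.uniformEquicontinuous _ C.toNNReal
    fun n => hlip (μ n) (hC n)).equicontinuous.isClosed_setOfPred_tendsto
      (hlip μ₀ le_rfl).continuous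

/-- On the unit cube, `u ↦ 1 - u j` is a survival function. -/
theorem one_sub_eval_mem_survivalSubmonoid {ι : Type*} [Fintype ι] (j : ι) :
    (⟨fun u => 1 - (u j : ℝ), by fun_prop⟩ : C(ι → Set.Icc (0:ℝ) 1, ℝ)) ∈
      survivalSubmonoid (ι → Set.Icc (0:ℝ) 1) := by
  classical
  have hm : Measurable fun t : Set.Icc (0:ℝ) 1 =>
      Function.update (⊤ : ι → Set.Icc (0:ℝ) 1) j t := measurable_update _
  refine ⟨(volume : Measure (Set.Icc (0:ℝ) 1)).map
    fun t => Function.update (⊤ : ι → Set.Icc (0:ℝ) 1) j t, inferInstance, fun u => ?_⟩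
  have hpre : (fun t => Function.update (⊤ : ι → Set.Icc (0:ℝ) 1) j t) ⁻¹' Set.Ici u =
      Set.Ici (u j) := by
    ext t
    simp only [Set.mem_preimage, Set.mem_Ici, le_update_iff, Pi.top_apply, le_top, implies_true,
      and_true]
  rw [map_measureReal_apply hm measurableSet_Ici, hpre, measureReal_def, unitInterval.volume_Ici,
    ENNReal.toReal_ofReal (sub_nonneg.2 (u j).2.2)]
  rfl

theorem topologicalClosure_adjoin_survivalSubmonoid {ι : Type*} [Fintype ι] :
    (Algebra.adjoin ℝ (survivalSubmonoid (ι → Set.Icc (0:ℝ) 1) :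
      Set C(ι → Set.Icc (0:ℝ) 1, ℝ))).topologicalClosure = ⊤ := by
  refine ContinuousMap.subalgebra_topologicalClosure_eq_top_of_separatesPoints _ fun u v huv => ?_
  obtain ⟨j, hj⟩ := Function.ne_iff.1 huv
  refine ⟨_, ⟨_, Algebra.subset_adjoin (one_sub_eval_mem_survivalSubmonoid j), rfl⟩, ?_⟩
  simpa [Subtype.ext_iff] using hj

/-- Pointwise convergence of c.d.f.s on the unit cube implies weak convergence. -/
theorem tendsto_integral_of_tendsto_real_Iic {ι : Type*} [Fintype ι]
    {μ : ℕ → Measure (ι → Set.Icc (0:ℝ) 1)} {μ₀ : Measure (ι → Set.Icc (0:ℝ) 1)}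
    [∀ n, IsFiniteMeasure (μ n)] [IsFiniteMeasure μ₀]
    (h : ∀ t, Tendsto (fun n => (μ n).real (Set.Iic t)) atTop (𝓝 (μ₀.real (Set.Iic t))))
    (f : C(ι → Set.Icc (0:ℝ) 1, ℝ)) :
    Tendsto (fun n => ∫ u, f u ∂μ n) atTop (𝓝 (∫ u, f u ∂μ₀)) := by
  obtain ⟨C, hC⟩ : ∃ C : ℝ, ∀ n, (μ n).real Set.univ ≤ C := by
    obtain ⟨C, hC⟩ := (h ⊤).bddAbove_range
    exact ⟨C, fun n => by simpa using hC ⟨n, rfl⟩⟩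
  have hf : f ∈ (Algebra.adjoin ℝ (survivalSubmonoid (ι → Set.Icc (0:ℝ) 1) :
      Set C(ι → Set.Icc (0:ℝ) 1, ℝ))).topologicalClosure := by
    rw [topologicalClosure_adjoin_survivalSubmonoid]
    trivial
  refine closure_minimal (fun g hg => ?_) (isClosed_setOf_tendsto_integral (μ₀ := μ₀) hC) hf
  have hg' : g ∈ Submodule.span ℝ (survivalSubmonoid (ι → Set.Icc (0:ℝ) 1) :
      Set C(ι → Set.Icc (0:ℝ) 1, ℝ)) := by
    have hg := (Subalgebra.mem_toSubmodule _).2 hg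
    rwa [Algebra.adjoin_eq_span, Submonoid.closure_eq] at hg
  rw [Set.mem_ofPred_eq]
  clear hg
  induction hg' using Submodule.span_induction with
  | mem g hg =>
    obtain ⟨τ, hτ, hgτ⟩ := hg
    simp only [hgτ]
    exact tendsto_integral_real_Ici_of_tendsto_real_Iic hC h τ
  | zero => simp
  | add g k _ _ hg hk =>
    simp only [ContinuousMap.add_apply]
    rw [integral_add (integrable_continuousMap_of_compactSpace μ₀ g)
      (integrable_continuousMap_of_compactSpace μ₀ k)]
    simp_rw [fun n => integral_add (integrable_continuousMap_of_compactSpace (μ n) g)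
      (integrable_continuousMap_of_compactSpace (μ n) k)]
    exact hg.add hk
  | smul c g _ hg =>
    simp only [ContinuousMap.smul_apply, integral_smul]
    exact hg.const_smul c

/-- If the c.d.f.s `bₙ` of finite Borel measures `βₙ` on `[0,1]^d`
converge uniformly to the continuous c.d.f. `b₀` of `β₀`, then `βₙ` converges
weakly to `β₀`: for every continuous `f`, `∫ f dβₙ → ∫ f dβ₀`. -/
theorem stmt3 (d : ℕ) (hd : 1 ≤ d)
    (β : ℕ → Measure (Fin d → Set.Icc (0:ℝ) 1))
    (β₀ : Measure (Fin d → Set.Icc (0:ℝ) 1))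
    (hβfin : ∀ n, IsFiniteMeasure (β n)) (hβ₀fin : IsFiniteMeasure β₀)
    (b : ℕ → (Fin d → Set.Icc (0:ℝ) 1) → ℝ) (b₀ : (Fin d → Set.Icc (0:ℝ) 1) → ℝ)
    (hb : ∀ n u, b n u = ((β n) {v | ∀ j, v j ≤ u j}).toReal)
    (hb₀ : ∀ u, b₀ u = (β₀ {v | ∀ j, v j ≤ u j}).toReal)
    (hb₀cont : Continuous b₀)
    (hbconv : TendstoUniformly b b₀ Filter.atTop) :
    ∀ f : (Fin d → Set.Icc (0:ℝ) 1) → ℝ, Continuous f →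
      Filter.Tendsto (fun n => ∫ u, f u ∂(β n)) Filter.atTop
        (nhds (∫ u, f u ∂β₀)) := by
  intro f hf
  refine tendsto_integral_of_tendsto_real_Iic (fun t => ?_) ⟨f, hf⟩
  have ht := hbconv.tendsto_at t
  simp only [hb, hb₀] at ht
  exact ht
end

section
/- Let d ≥ 1 and let r ≥ 1 be a real number. Let h_n, h : [0,1]^d → [0,1] for n ∈ ℕ, let G : [0,1]^d → ℝ, and let (c_n) be positive reals with c_n → ∞. If sup_{u ∈ [0,1]^d} |c_n (h_n(u) − h(u)) − G(u)| → 0 as n → ∞, then sup_{u ∈ [0,1]^d} |c_n ((h_n(u))^r − (h(u))^r) − r (h(u))^{r−1} G(u)| → 0 as n → ∞ (a uniform deterministic delta method for the power map x ↦ x^r). -/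
/-- Mean value theorem for `x ↦ x ^ r` with `r ≥ 1`, including coinciding endpoints. -/
theorem Real.exists_rpow_sub_rpow_eq {r : ℝ} (hr : 1 ≤ r) (x y : ℝ) :
    ∃ z ∈ Set.uIcc x y, x ^ r - y ^ r = r * z ^ (r - 1) * (x - y) := by
  have key : ∀ a b : ℝ, a < b →
      ∃ z ∈ Set.Icc a b, b ^ r - a ^ r = r * z ^ (r - 1) * (b - a) := by
    intro a b hab
    have hd : ∀ z, HasDerivAt (fun t : ℝ => t ^ r) (r * z ^ (r - 1)) z :=
      fun z => Real.hasDerivAt_rpow_const (Or.inr hr)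
    obtain ⟨z, hz, hzeq⟩ := exists_hasDerivAt_eq_slope (fun t : ℝ => t ^ r)
      (fun z => r * z ^ (r - 1)) hab (fun z _ => (hd z).continuousAt.continuousWithinAt)
      (fun z _ => hd z)
    refine ⟨z, Set.Ioo_subset_Icc_self hz, ?_⟩
    rw [hzeq, div_mul_cancel₀ _ (sub_pos.2 hab).ne']
  rcases lt_trichotomy x y with hxy | rfl | hxy
  · obtain ⟨z, hz, e⟩ := key x y hxy
    exact ⟨z, Set.Icc_subset_uIcc hz, by linarith⟩
  · exact ⟨x, Set.left_mem_uIcc, by simp⟩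
  · obtain ⟨z, hz, e⟩ := key y x hxy
    exact ⟨z, Set.Icc_subset_uIcc' hz, e⟩

/-- a uniform deterministic delta method for the power map `x ↦ x^r`
(`r ≥ 1`, real powers) on `[0,1]^d`-indexed families of `[0,1]`-valued functions. -/
theorem stmt4 (d : ℕ) (hd : 1 ≤ d) (r : ℝ) (hr : 1 ≤ r)
    (h : ℕ → (Fin d → ℝ) → ℝ) (h₀ : (Fin d → ℝ) → ℝ) (G : (Fin d → ℝ) → ℝ)
    (hrange : ∀ n, ∀ u : Fin d → ℝ, (∀ i, u i ∈ Set.Icc (0:ℝ) 1) →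
        h n u ∈ Set.Icc (0:ℝ) 1)
    (hrange₀ : ∀ u : Fin d → ℝ, (∀ i, u i ∈ Set.Icc (0:ℝ) 1) →
        h₀ u ∈ Set.Icc (0:ℝ) 1)
    (c : ℕ → ℝ) (hcpos : ∀ n, 0 < c n)
    (hc : Filter.Tendsto c Filter.atTop Filter.atTop)
    (hconv : ∀ ε > (0:ℝ), ∃ N : ℕ, ∀ n ≥ N, ∀ u : Fin d → ℝ,
        (∀ i, u i ∈ Set.Icc (0:ℝ) 1) → |c n * (h n u - h₀ u) - G u| < ε) :
    ∀ ε > (0:ℝ), ∃ N : ℕ, ∀ n ≥ N, ∀ u : Fin d → ℝ,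
        (∀ i, u i ∈ Set.Icc (0:ℝ) 1) →
        |c n * ((h n u) ^ r - (h₀ u) ^ r) - r * (h₀ u) ^ (r - 1) * G u| < ε := by
  intro ε hε
  have hr0 : 0 < r := by linarith
  obtain ⟨N₁, hN₁⟩ := hconv 1 one_pos
  obtain ⟨B, hB, hGB⟩ : ∃ B : ℝ, 0 < B ∧
      ∀ u : Fin d → ℝ, (∀ i, u i ∈ Set.Icc (0:ℝ) 1) → |G u| ≤ B := by
    refine ⟨c N₁ + 1, by linarith [hcpos N₁], fun u hu => ?_⟩
    have h1 := abs_lt.1 (hN₁ N₁ le_rfl u hu)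
    obtain ⟨a0, a1⟩ := hrange N₁ u hu
    obtain ⟨b0, b1⟩ := hrange₀ u hu
    have hc1 := hcpos N₁
    rw [abs_le]
    constructor <;> nlinarith
  have huc : UniformContinuousOn (fun x : ℝ => x ^ (r - 1)) (Set.Icc 0 1) :=
    isCompact_Icc.uniformContinuousOn_of_continuous
      (Real.continuous_rpow_const (by linarith)).continuousOn
  obtain ⟨δ, hδ, hδuc⟩ := Metric.uniformContinuousOn_iff.1 huc (ε / (2 * r * B)) (by positivity)
  obtain ⟨N₂, hN₂⟩ := hconv (ε / (2 * r)) (by positivity)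
  obtain ⟨N₃, hN₃⟩ := Filter.eventually_atTop.1 (hc.eventually_gt_atTop ((B + 1) / δ))
  refine ⟨max N₁ (max N₂ N₃), fun n hn u hu => ?_⟩
  simp only [ge_iff_le, max_le_iff] at hn
  have h1 := hN₁ n hn.1 u hu
  have h2 := hN₂ n hn.2.1 u hu
  have h3 := (div_lt_iff₀ hδ).1 (hN₃ n hn.2.2)
  have hG := hGB u hu
  have hclose : |h n u - h₀ u| < δ := by
    have hbound : c n * |h n u - h₀ u| < c n * δ := by
      rw [← abs_of_pos (hcpos n), ← abs_mul, abs_of_pos (hcpos n)]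
      linarith [abs_sub_abs_le_abs_sub (c n * (h n u - h₀ u)) (G u)]
    exact lt_of_mul_lt_mul_left hbound (hcpos n).le
  obtain ⟨z, hz, hzeq⟩ := Real.exists_rpow_sub_rpow_eq hr (h n u) (h₀ u)
  have hz01 : z ∈ Set.Icc (0:ℝ) 1 := Set.uIcc_subset_Icc (hrange n u hu) (hrange₀ u hu) hz
  have hzδ : dist z (h₀ u) < δ := by
    rw [Real.dist_eq, abs_sub_comm]
    refine (Set.abs_sub_right_of_mem_uIcc hz).trans_lt ?_
    rwa [abs_sub_comm]
  have hω := hδuc z hz01 (h₀ u) (hrange₀ u hu) hzδ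
  rw [Real.dist_eq] at hω
  have hz0 : 0 ≤ z ^ (r - 1) := Real.rpow_nonneg hz01.1 _
  have hz1 : z ^ (r - 1) ≤ 1 := Real.rpow_le_one hz01.1 hz01.2 (by linarith)
  have hsplit : c n * ((h n u) ^ r - (h₀ u) ^ r) - r * (h₀ u) ^ (r - 1) * G u =
      r * (z ^ (r - 1) * (c n * (h n u - h₀ u) - G u)) +
        r * ((z ^ (r - 1) - (h₀ u) ^ (r - 1)) * G u) := by
    rw [hzeq]; ring
  have hA : |r * (z ^ (r - 1) * (c n * (h n u - h₀ u) - G u))| < ε / 2 := by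
    rw [abs_mul, abs_mul, abs_of_pos hr0, abs_of_nonneg hz0]
    calc r * (z ^ (r - 1) * |c n * (h n u - h₀ u) - G u|)
        ≤ r * (1 * |c n * (h n u - h₀ u) - G u|) := by gcongr
      _ < r * (1 * (ε / (2 * r))) := by gcongr
      _ = ε / 2 := by field_simp
  have hB' : |r * ((z ^ (r - 1) - (h₀ u) ^ (r - 1)) * G u)| ≤ ε / 2 := by
    rw [abs_mul, abs_mul, abs_of_pos hr0]
    calc r * (|z ^ (r - 1) - (h₀ u) ^ (r - 1)| * |G u|)
        ≤ r * (ε / (2 * r * B) * B) := by gcongr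
      _ = ε / 2 := by field_simp
  rw [hsplit]
  linarith [abs_add_le (r * (z ^ (r - 1) * (c n * (h n u - h₀ u) - G u)))
    (r * ((z ^ (r - 1) - (h₀ u) ^ (r - 1)) * G u))]
end

section
/- Let d ≥ 1, let C : [0,1]^d → ℝ be continuous, let j ∈ {1,…,d}, and let V_j = {u ∈ [0,1]^d : 0 < u_j < 1}. Suppose there is a function g, continuous on all of [0,1]^d, such that for every u ∈ V_j the function t ↦ C(u_1,…,u_{j−1}, t, u_{j+1},…,u_d) is differentiable at u_j with derivative g(u). Then sup_{u ∈ [0,1]^d} | C^{[j]}_n(u) − g(u) | → 0 as n → ∞, where C^{[j]}_n is the difference-quotient estimator applied to C itself. -/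
/-- `u⁺ₙ = (u + n^{-1/2}) ∧ 1`. -/
noncomputable def upPt (n : ℕ) (x : ℝ) : ℝ := min (x + 1 / Real.sqrt n) 1

/-- `u⁻ₙ = (u − n^{-1/2}) ∨ 0`. -/
noncomputable def loPt (n : ℕ) (x : ℝ) : ℝ := max (x - 1 / Real.sqrt n) 0

/-- Difference-quotient partial-derivative estimator `H^{[j]}ₙ`. -/
noncomputable def diffQuot {d : ℕ} (H : (Fin d → ℝ) → ℝ) (n : ℕ) (j : Fin d)
    (u : Fin d → ℝ) : ℝ :=
  (H (Function.update u j (upPt n (u j))) - H (Function.update u j (loPt n (u j)))) /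
    (upPt n (u j) - loPt n (u j))

/-- By the mean value theorem, the difference quotient equals the partial derivative at a point
whose `j`-th coordinate lies strictly between the two evaluation points. -/
theorem exists_diffQuot_eq {d : ℕ} {C g : (Fin d → ℝ) → ℝ} {j : Fin d}
    (hC : ContinuousOn C {u : Fin d → ℝ | ∀ i, u i ∈ Set.Icc (0:ℝ) 1})
    (hderiv : ∀ u : Fin d → ℝ, (∀ i, u i ∈ Set.Icc (0:ℝ) 1) → 0 < u j → u j < 1 →
        HasDerivAt (fun t => C (Function.update u j t)) (g u) (u j))
    {n : ℕ} (hn : 0 < n) {u : Fin d → ℝ} (hu : ∀ i, u i ∈ Set.Icc (0:ℝ) 1) :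
    ∃ c ∈ Set.Ioo (loPt n (u j)) (upPt n (u j)),
      diffQuot C n j u = g (Function.update u j c) := by
  have hs : 0 < 1 / Real.sqrt n := by positivity
  have hlo : 0 ≤ loPt n (u j) := le_max_right _ _
  have hup : upPt n (u j) ≤ 1 := min_le_right _ _
  have hlt : loPt n (u j) < upPt n (u j) := by
    obtain ⟨h0, h1⟩ := hu j
    refine max_lt (lt_min ?_ ?_) (lt_min ?_ ?_) <;> linarith
  have hmem : ∀ t ∈ Set.Icc (0:ℝ) 1, ∀ i, Function.update u j t i ∈ Set.Icc (0:ℝ) 1 := by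
    intro t ht i
    obtain rfl | hi := eq_or_ne i j
    · simpa using ht
    · simpa [hi] using hu i
  obtain ⟨c, hc, hceq⟩ := exists_hasDerivAt_eq_slope (fun t => C (Function.update u j t))
    (fun t => g (Function.update u j t)) hlt
    (hC.comp (by fun_prop) fun t ht => hmem t ⟨hlo.trans ht.1, ht.2.trans hup⟩)
    (fun t ht => by
      have h0 : 0 < t := hlo.trans_lt ht.1
      have h1 : t < 1 := ht.2.trans_le hup
      simpa using hderiv (Function.update u j t) (hmem t ⟨h0.le, h1.le⟩)
        (by simpa using h0) (by simpa using h1))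
  exact ⟨c, hc, hceq.symm⟩

/-- if `C` is continuous on `[0,1]^d`, its `j`-th partial derivative
exists on `V_j = {u ∈ [0,1]^d : 0 < u_j < 1}` and equals there a function `g`
which is continuous on all of `[0,1]^d`, then the difference-quotient estimator
applied to `C` converges to `g` uniformly on `[0,1]^d`. -/
theorem stmt11 (d : ℕ) (hd : 1 ≤ d) (C : (Fin d → ℝ) → ℝ)
    (hCcont : ContinuousOn C {u : Fin d → ℝ | ∀ i, u i ∈ Set.Icc (0:ℝ) 1})
    (j : Fin d) (g : (Fin d → ℝ) → ℝ)
    (hgcont : ContinuousOn g {u : Fin d → ℝ | ∀ i, u i ∈ Set.Icc (0:ℝ) 1})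
    (hderiv : ∀ u : Fin d → ℝ, (∀ i, u i ∈ Set.Icc (0:ℝ) 1) → 0 < u j → u j < 1 →
        HasDerivAt (fun t => C (Function.update u j t)) (g u) (u j)) :
    ∀ ε > (0:ℝ), ∃ N : ℕ, ∀ n ≥ N, ∀ u : Fin d → ℝ,
      (∀ i, u i ∈ Set.Icc (0:ℝ) 1) → |diffQuot C n j u - g u| < ε := by
  intro ε hε
  have hset : {u : Fin d → ℝ | ∀ i, u i ∈ Set.Icc (0:ℝ) 1} =
      Set.univ.pi fun _ => Set.Icc (0:ℝ) 1 := by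
    ext u
    simp only [Set.mem_ofPred_eq, Set.mem_univ_pi]
  have hK : IsCompact {u : Fin d → ℝ | ∀ i, u i ∈ Set.Icc (0:ℝ) 1} :=
    hset ▸ isCompact_univ_pi fun _ => isCompact_Icc
  obtain ⟨δ, hδ, hg⟩ :=
    Metric.uniformContinuousOn_iff.mp (hK.uniformContinuousOn_of_continuous hgcont) ε hε
  have hlim : Filter.Tendsto (fun n : ℕ => 1 / Real.sqrt n) Filter.atTop (nhds 0) := by
    simpa only [one_div, Function.comp_def] using tendsto_inv_atTop_zero.comp
      (Real.tendsto_sqrt_atTop.comp (tendsto_natCast_atTop_atTop (R := ℝ)))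
  obtain ⟨N, hN⟩ := Filter.eventually_atTop.mp
    ((hlim.eventually_lt_const hδ).and (Filter.eventually_gt_atTop 0))
  refine ⟨N, fun n hn u hu => ?_⟩
  obtain ⟨hnδ, hn0⟩ := hN n hn
  obtain ⟨c, ⟨hc₁, hc₂⟩, hc⟩ := exists_diffQuot_eq hCcont hderiv hn0 hu
  obtain ⟨hc₁, hc0⟩ := max_lt_iff.mp hc₁
  obtain ⟨hc₂, hc1⟩ := lt_min_iff.mp hc₂
  rw [hc, ← Real.dist_eq]
  refine hg _ (fun i => ?_) u hu ((dist_pi_lt_iff hδ).mpr fun i => ?_)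
  · obtain rfl | hi := eq_or_ne i j
    · simpa using ⟨hc0.le, hc1.le⟩
    · simpa [hi] using hu i
  · obtain rfl | hi := eq_or_ne i j
    · rw [Function.update_self, Real.dist_eq, abs_lt]
      constructor <;> linarith
    · simpa [hi] using hδ
end

section
/- Let d ≥ 1. For each n ∈ ℕ let D_n : [0,1]^d → ℝ be a bounded Borel measurable function and let β_n be a finite Borel measure on [0,1]^d with c.d.f. b_n; let D : [0,1]^d → ℝ be continuous and let β_0 be a finite Borel measure on [0,1]^d with continuous c.d.f. b_0. If sup_{u ∈ [0,1]^d} |D_n(u) − D(u)| → 0 and sup_{u ∈ [0,1]^d} |b_n(u) − b_0(u)| → 0 as n → ∞, then ∫_{[0,1]^d} (D_n)^2 dβ_n → ∫_{[0,1]^d} D^2 dβ_0 as n → ∞ (the deterministic mechanism behind the convergence of the Cramér–von Mises statistic T_{r,n} = ∫ (D_{r,n})^2 dC_n). -/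
open MeasureTheory

/-- The algebra of step functions generated by the indicators of lower orthants. -/
noncomputable def orthantAlgebra (X : Type*) [Preorder X] : Subalgebra ℝ (X → ℝ) :=
  Algebra.adjoin ℝ (Set.range fun u : X => (Set.Iic u).indicator (1 : X → ℝ))

/-- Indicators of lower orthants of a bounded-above semilattice are closed under multiplication,
so they span the algebra they generate. -/
lemma mem_span_of_mem_orthantAlgebra {X : Type*} [SemilatticeInf X] [OrderTop X] {g : X → ℝ}
    (hg : g ∈ orthantAlgebra X) :
    g ∈ Submodule.span ℝ (Set.range fun u : X => (Set.Iic u).indicator (1 : X → ℝ)) := by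
  have h : g ∈ Subalgebra.toSubmodule (orthantAlgebra X) := hg
  rw [orthantAlgebra, Algebra.adjoin_eq_span] at h
  refine Submodule.span_mono ?_ h
  intro f hf
  induction hf using Submonoid.closure_induction with
  | mem x hx => exact hx
  | one => exact ⟨⊤, by simp⟩
  | mul x y _ _ hx hy =>
    obtain ⟨u, rfl⟩ := hx
    obtain ⟨w, rfl⟩ := hy
    refine ⟨u ⊓ w, ?_⟩
    simp only [← Set.Iic_inter_Iic]
    exact Set.inter_indicator_one

/-- Convergence of c.d.f.s implies convergence of the integrals of step functions. -/
lemma tendsto_integral_of_mem_orthantAlgebra {X : Type*} [SemilatticeInf X] [OrderTop X]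
    [MeasurableSpace X] (hIic : ∀ u : X, MeasurableSet (Set.Iic u))
    (β : ℕ → Measure X) (β₀ : Measure X) [∀ n, IsFiniteMeasure (β n)] [IsFiniteMeasure β₀]
    (h : ∀ u, Filter.Tendsto (fun n => (β n).real (Set.Iic u)) Filter.atTop
      (nhds (β₀.real (Set.Iic u)))) {g : X → ℝ} (hg : g ∈ orthantAlgebra X) :
    (∀ n, Integrable g (β n)) ∧ Integrable g β₀ ∧
      Filter.Tendsto (fun n => ∫ u, g u ∂(β n)) Filter.atTop (nhds (∫ u, g u ∂β₀)) := by
  have hs := mem_span_of_mem_orthantAlgebra hg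
  induction hs using Submodule.span_induction with
  | mem x hx =>
    obtain ⟨u, rfl⟩ := hx
    have hint : ∀ (μ : Measure X) [IsFiniteMeasure μ],
        Integrable ((Set.Iic u).indicator (1 : X → ℝ)) μ := fun μ _ =>
      (integrable_const (1 : ℝ)).indicator (hIic u)
    refine ⟨fun n => hint _, hint _, ?_⟩
    simpa [integral_indicator_one (hIic u)] using h u
  | zero => simp
  | add x y hxs hys hx hy =>
    have hmem : ∀ z ∈ Submodule.span ℝ
        (Set.range fun u : X => (Set.Iic u).indicator (1 : X → ℝ)), z ∈ orthantAlgebra X :=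
      fun z hz => Algebra.span_le_adjoin ℝ _ hz
    obtain ⟨hx1, hx2, hx3⟩ := hx (hmem x hxs)
    obtain ⟨hy1, hy2, hy3⟩ := hy (hmem y hys)
    refine ⟨fun n => (hx1 n).add (hy1 n), hx2.add hy2, ?_⟩
    simp only [Pi.add_apply]
    rw [integral_add hx2 hy2]
    simp_rw [fun n => integral_add (hx1 n) (hy1 n)]
    exact hx3.add hy3
  | smul a x hxs hx =>
    obtain ⟨hx1, hx2, hx3⟩ := hx (Algebra.span_le_adjoin ℝ _ hxs)
    refine ⟨fun n => (hx1 n).smul a, hx2.smul a, ?_⟩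
    simp only [Pi.smul_apply, smul_eq_mul, integral_const_mul]
    exact hx3.const_mul a

/-- The point `i / k` of the unit interval. -/
noncomputable def gridPoint (k : ℕ) (i : Fin (k + 1)) : Set.Icc (0 : ℝ) 1 :=
  ⟨i / k, by positivity, div_le_one_of_le₀ (by exact_mod_cast Nat.le_of_lt_succ i.2)
    (by positivity)⟩

/-- The indicator of the grid cell `((i - 1) / k, i / k]` (of `{0}` if `i = 0`). -/
noncomputable def gridCell (k i : ℕ) (x : ℝ) : ℝ :=
  (if x ≤ i / k then 1 else 0) - (if i ≠ 0 ∧ x ≤ ((i - 1 : ℕ) : ℝ) / k then 1 else 0)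

lemma gridCell_nonneg (k i : ℕ) (x : ℝ) : 0 ≤ gridCell k i x := by
  have h : ((i - 1 : ℕ) : ℝ) / k ≤ i / k := by
    gcongr
    omega
  unfold gridCell
  split_ifs with h1 h2 h2
  · simp
  · simp
  · exact absurd (h2.2.trans h) h1
  · simp

lemma abs_sub_le_of_gridCell_ne_zero {k i : ℕ} {x : ℝ} (hx : 0 ≤ x) (h : gridCell k i x ≠ 0) :
    |x - i / k| ≤ 1 / k := by
  unfold gridCell at h
  have hk : (0 : ℝ) ≤ 1 / k := by positivity
  rcases i with _ | i
  · split_ifs at h with h1 h2 <;> simp_all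
    have : x = 0 := le_antisymm h1 hx
    simp [this]
  · simp only [ne_eq, Nat.add_eq_zero_iff, one_ne_zero, and_false, not_false_eq_true, true_and,
      Nat.add_sub_cancel, Nat.cast_add, Nat.cast_one, add_div] at h ⊢
    split_ifs at h with h1 h2 h2
    · simp at h
    · rw [abs_le]
      constructor <;> linarith
    · linarith
    · simp at h

lemma sum_gridCell {k : ℕ} (hk : 0 < k) {x : ℝ} (hx : x ≤ 1) :
    ∑ i : Fin (k + 1), gridCell k i x = 1 := by
  have h : ∀ m : ℕ, ∑ i ∈ Finset.range (m + 1), gridCell k i x =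
      if x ≤ (m : ℝ) / k then 1 else 0 := by
    intro m
    induction m with
    | zero =>
      rw [Finset.sum_range_one]
      simp [gridCell]
    | succ m ih =>
      rw [Finset.sum_range_succ, ih]
      simp [gridCell]
  have hk' : (k : ℝ) ≠ 0 := by positivity
  rw [Fin.sum_univ_eq_sum_range (fun i => gridCell k i x) (k + 1), h, div_self hk', if_pos hx]

/-- Indicators of grid cells in one coordinate are step functions. -/
lemma gridCell_mem_orthantAlgebra {ι : Type*} [DecidableEq ι] (k : ℕ) (i : Fin (k + 1)) (j : ι) :
    (fun v : ι → Set.Icc (0 : ℝ) 1 => gridCell k i (v j)) ∈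
      orthantAlgebra (ι → Set.Icc (0 : ℝ) 1) := by
  have key : ∀ i : Fin (k + 1), (fun v : ι → Set.Icc (0 : ℝ) 1 =>
      if (v j : ℝ) ≤ ((i : ℕ) : ℝ) / k then (1 : ℝ) else 0) ∈
        orthantAlgebra (ι → Set.Icc (0 : ℝ) 1) := by
    intro i
    refine Algebra.subset_adjoin ⟨Function.update ⊤ j (gridPoint k i), ?_⟩
    ext v
    have h : v ≤ Function.update ⊤ j (gridPoint k i) ↔ (v j : ℝ) ≤ ((i : ℕ) : ℝ) / k := by
      rw [le_update_iff]
      simp only [Pi.top_apply, le_top, implies_true, and_true]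
      exact Iff.rfl
    split_ifs with hv
    · exact Set.indicator_of_mem (h.2 hv) _
    · exact Set.indicator_of_notMem (fun hv' => hv (h.1 hv')) _
  refine Subalgebra.sub_mem _ (key i) ?_
  by_cases hi : (i : ℕ) = 0
  · simp only [hi, ne_eq, not_true_eq_false, false_and, if_false]
    exact Subalgebra.zero_mem _
  · simpa [hi] using key ⟨i - 1, by omega⟩

/-- Continuous functions on the cube are uniform limits of step functions. -/
lemma exists_mem_orthantAlgebra_abs_sub_le {ι : Type*} [Fintype ι] [DecidableEq ι]
    {f : (ι → Set.Icc (0 : ℝ) 1) → ℝ} (hf : Continuous f) {ε : ℝ} (hε : 0 < ε) :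
    ∃ g ∈ orthantAlgebra (ι → Set.Icc (0 : ℝ) 1), ∀ v, |f v - g v| ≤ ε := by
  obtain ⟨δ, hδ, hfδ⟩ := Metric.uniformContinuous_iff.1
    (CompactSpace.uniformContinuous_of_continuous hf) ε hε
  obtain ⟨m, hm⟩ := exists_nat_one_div_lt hδ
  set k := m + 1 with hk
  have hkδ : 1 / (k : ℝ) < δ := by simpa [hk] using hm
  let c : (ι → Fin (k + 1)) → (ι → Set.Icc (0 : ℝ) 1) → ℝ :=
    fun i v => ∏ j, gridCell k (i j) (v j)
  have hc_nonneg : ∀ i v, 0 ≤ c i v := fun i v =>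
    Finset.prod_nonneg fun j _ => gridCell_nonneg _ _ _
  have hc_sum : ∀ v, ∑ i, c i v = 1 := by
    intro v
    have := Finset.prod_univ_sum (fun _ : ι => (Finset.univ : Finset (Fin (k + 1))))
      (fun j i => gridCell k i (v j))
    rw [Fintype.piFinset_univ] at this
    simp only [c]
    rw [← this]
    exact Finset.prod_eq_one fun j _ => sum_gridCell (Nat.succ_pos m) (v j).2.2
  refine ⟨∑ i, f (fun j => gridPoint k (i j)) • c i, ?_, fun v => ?_⟩
  · refine Subalgebra.sum_mem _ fun i _ => Subalgebra.smul_mem _ ?_ _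
    have : c i = ∏ j, fun v : ι → Set.Icc (0 : ℝ) 1 => gridCell k (i j) (v j) := by
      ext v
      simp [c]
    rw [this]
    exact Subalgebra.prod_mem _ fun j _ => gridCell_mem_orthantAlgebra k (i j) j
  · have h1 : f v - (∑ i, f (fun j => gridPoint k (i j)) • c i) v =
        ∑ i, (f v - f (fun j => gridPoint k (i j))) * c i v := by
      simp only [sub_mul, Finset.sum_sub_distrib, ← Finset.mul_sum, hc_sum, mul_one,
        Finset.sum_apply, Pi.smul_apply, smul_eq_mul]
    rw [h1]
    calc |∑ i, (f v - f (fun j => gridPoint k (i j))) * c i v|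
        ≤ ∑ i, |(f v - f (fun j => gridPoint k (i j))) * c i v| :=
          Finset.abs_sum_le_sum_abs _ _
      _ ≤ ∑ i, ε * c i v := by
          refine Finset.sum_le_sum fun i _ => ?_
          rw [abs_mul, abs_of_nonneg (hc_nonneg i v)]
          by_cases h0 : c i v = 0
          · simp [h0]
          refine mul_le_mul_of_nonneg_right ?_ (hc_nonneg i v)
          refine (hfδ ?_).le
          refine (dist_pi_lt_iff hδ).2 fun j => ?_
          refine lt_of_le_of_lt ?_ hkδ
          exact abs_sub_le_of_gridCell_ne_zero (v j).2.1 (Finset.prod_ne_zero_iff.1 h0 j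
            (Finset.mem_univ j))
      _ = ε := by rw [← Finset.mul_sum, hc_sum, mul_one]

/-- Squaring preserves uniform convergence to a bounded limit. -/
lemma TendstoUniformly.sq_of_bounded {α κ : Type*} {l : Filter κ} {F : κ → α → ℝ} {f : α → ℝ}
    (h : TendstoUniformly F f l) {C : ℝ} (hC : ∀ x, |f x| ≤ C) :
    TendstoUniformly (fun n x => F n x ^ 2) (fun x => f x ^ 2) l := by
  rw [Metric.tendstoUniformly_iff] at h ⊢
  intro ε hε
  have hpos : 0 < 2 * |C| + 1 := by positivity
  filter_upwards [h (min 1 (ε / (2 * |C| + 1))) (by positivity)] with n hn x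
  have hx := hn x
  rw [Real.dist_eq, lt_min_iff, lt_div_iff₀ hpos] at hx
  rw [Real.dist_eq, sq_sub_sq, abs_mul, mul_comm]
  refine lt_of_le_of_lt (mul_le_mul_of_nonneg_left ?_ (abs_nonneg _)) hx.2
  have h1 := (hC x).trans (le_abs_self C)
  have h2 : f x + F n x = 2 * f x - (f x - F n x) := by ring
  rw [h2]
  refine (abs_sub _ _).trans ?_
  rw [abs_mul, abs_two]
  linarith

/-- If c.d.f.s of finite measures on the cube converge pointwise, then integrals of uniformly
convergent functions with continuous limit converge. -/
lemma tendsto_integral_of_tendstoUniformly_of_tendsto_cdf {ι : Type*} [Fintype ι]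
    (β : ℕ → Measure (ι → Set.Icc (0 : ℝ) 1)) (β₀ : Measure (ι → Set.Icc (0 : ℝ) 1))
    [∀ n, IsFiniteMeasure (β n)] [IsFiniteMeasure β₀]
    (h : ∀ u, Filter.Tendsto (fun n => (β n).real (Set.Iic u)) Filter.atTop
      (nhds (β₀.real (Set.Iic u))))
    {F : ℕ → (ι → Set.Icc (0 : ℝ) 1) → ℝ} {f : (ι → Set.Icc (0 : ℝ) 1) → ℝ}
    (hF : ∀ n, Integrable (F n) (β n)) (hf : Continuous f)
    (hFf : TendstoUniformly F f Filter.atTop) :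
    Filter.Tendsto (fun n => ∫ u, F n u ∂(β n)) Filter.atTop (nhds (∫ u, f u ∂β₀)) := by
  classical
  have hmass : Filter.Tendsto (fun n => (β n).real Set.univ) Filter.atTop
      (nhds (β₀.real Set.univ)) := by
    simpa using h ⊤
  have hf_int : Integrable f β₀ := hf.integrable_of_hasCompactSupport
    (HasCompactSupport.of_compactSpace f)
  rw [Metric.tendsto_nhds]
  intro ε hε
  set M := β₀.real Set.univ
  have hM : 0 ≤ M := measureReal_nonneg
  set η := ε / (4 * (M + 1)) with hη_def
  have hη : 0 < η := by positivity
  have hηM : 4 * (η * (M + 1)) = ε := by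
    rw [hη_def]
    field_simp
  obtain ⟨g, hg, hfg⟩ := exists_mem_orthantAlgebra_abs_sub_le hf hη
  obtain ⟨hg1, hg2, hg3⟩ := tendsto_integral_of_mem_orthantAlgebra
    (fun u => measurableSet_Iic) β β₀ h hg
  filter_upwards [Metric.tendstoUniformly_iff.1 hFf η hη, Metric.tendsto_nhds.1 hg3 η hη,
    hmass.eventually_lt_const (lt_add_one M)] with n hn1 hn2 hn3
  have e1 : |∫ u, F n u ∂(β n) - ∫ u, g u ∂(β n)| ≤ 2 * η * (M + 1) := by
    rw [← integral_sub (hF n) (hg1 n)]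
    refine (norm_integral_le_of_norm_le_const (μ := β n)
      (f := fun u => F n u - g u) (C := 2 * η)
      (.of_forall fun u => ?_)).trans ?_
    · have h1 := hn1 u
      rw [dist_comm, Real.dist_eq] at h1
      have h2 := abs_sub_le (F n u) (f u) (g u)
      have h3 := hfg u
      rw [Real.norm_eq_abs]
      linarith
    · gcongr
  have e2 : |∫ u, f u ∂β₀ - ∫ u, g u ∂β₀| ≤ η * M := by
    rw [← integral_sub hf_int hg2]
    exact norm_integral_le_of_norm_le_const (μ := β₀) (f := fun u => f u - g u)
      (.of_forall hfg)
  rw [Real.dist_eq] at hn2 ⊢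
  rw [abs_le] at e1 e2
  rw [abs_lt] at hn2 ⊢
  constructor <;> nlinarith

/-- if `Dₙ → D` uniformly with `D` continuous, and the c.d.f.s `bₙ`
of the finite Borel measures `βₙ` on `[0,1]^d` converge uniformly to the continuous
c.d.f. `b₀` of `β₀`, then `∫ (Dₙ)² dβₙ → ∫ D² dβ₀`. -/
theorem stmt14 (d : ℕ) (hd : 1 ≤ d)
    (β : ℕ → Measure (Fin d → Set.Icc (0:ℝ) 1))
    (β₀ : Measure (Fin d → Set.Icc (0:ℝ) 1))
    (hβfin : ∀ n, IsFiniteMeasure (β n)) (hβ₀fin : IsFiniteMeasure β₀)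
    (D : ℕ → (Fin d → Set.Icc (0:ℝ) 1) → ℝ) (D₀ : (Fin d → Set.Icc (0:ℝ) 1) → ℝ)
    (hDmeas : ∀ n, Measurable (D n)) (hDbdd : ∀ n, ∃ M : ℝ, ∀ u, |D n u| ≤ M)
    (hD₀cont : Continuous D₀)
    (b : ℕ → (Fin d → Set.Icc (0:ℝ) 1) → ℝ) (b₀ : (Fin d → Set.Icc (0:ℝ) 1) → ℝ)
    (hb : ∀ n u, b n u = ((β n) {v | ∀ j, v j ≤ u j}).toReal)
    (hb₀ : ∀ u, b₀ u = (β₀ {v | ∀ j, v j ≤ u j}).toReal)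
    (hb₀cont : Continuous b₀)
    (hDconv : TendstoUniformly D D₀ Filter.atTop)
    (hbconv : TendstoUniformly b b₀ Filter.atTop) :
    Filter.Tendsto (fun n => ∫ u, (D n u) ^ 2 ∂(β n)) Filter.atTop
      (nhds (∫ u, (D₀ u) ^ 2 ∂β₀)) := by
  obtain ⟨C, hC⟩ := isCompact_univ.exists_bound_of_continuousOn hD₀cont.continuousOn
  refine tendsto_integral_of_tendstoUniformly_of_tendsto_cdf β β₀ (fun u => ?_) (fun n => ?_)
    (hD₀cont.pow 2) (hDconv.sq_of_bounded fun x => hC x (Set.mem_univ x))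
  · have h := hbconv.tendsto_at u
    simp only [hb, hb₀] at h
    exact h
  · obtain ⟨M, hM⟩ := hDbdd n
    refine Integrable.of_bound ((hDmeas n).pow_const 2).aestronglyMeasurable (M ^ 2)
      (.of_forall fun u => ?_)
    rw [norm_pow, Real.norm_eq_abs]
    exact pow_le_pow_left₀ (abs_nonneg _) (hM u) 2
end
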